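/- Let ℓ : ℝⁿ → ℝ be a C² function which is strictly convex and superlinear, regarded as the completely integrable Tonelli Lagrangian L(x,v) = ℓ(v) on 𝕋ⁿ, and let V : 𝕋ⁿ → ℝ be a C² function with max V = 0. Let h ∈ ℝⁿ with h ≠ 0 and set ℓ_V(x,v) = ℓ(v) + V(x). Then β_{ℓ_V}(h) = β_ℓ(h) if and only if V ≡ 0 on 𝕋ⁿ. -/

import Mathlib

open MeasureTheory

noncomputable section

/-- The flat `n`-torus `𝕋ⁿ = ℝⁿ/ℤⁿ`. -/
abbrev Torus (n : ℕ) := Fin n → AddCircle (1 : ℝ)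

/-- The canonical projection `ℝⁿ → 𝕋ⁿ`. -/
def Torus.proj {n : ℕ} (x : Fin n → ℝ) : Torus n := fun i => (x i : AddCircle (1 : ℝ))

/-- `ℤⁿ`-periodicity of a function on `ℝⁿ` (i.e. it descends to the torus `𝕋ⁿ`). -/
def ZPeriodic {n : ℕ} {E : Type*} (F : (Fin n → ℝ) → E) : Prop :=
  ∀ (x : Fin n → ℝ) (k : Fin n → ℤ), F (x + fun i => (k i : ℝ)) = F x

/-- A closed Borel probability measure on `𝕋ⁿ × ℝⁿ`: it has finite first moment and
`∫ df_x(v) dμ(x,v) = 0` for every `C¹` function `f` on the torus; such an `f` is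
represented by its `ℤⁿ`-periodic lift `F : ℝⁿ → ℝ`, whose differential descends to a
function `DF` on the torus. -/
def IsClosedMeasure {n : ℕ} (μ : Measure (Torus n × (Fin n → ℝ))) : Prop :=
  IsProbabilityMeasure μ ∧
  Integrable (fun p : Torus n × (Fin n → ℝ) => ‖p.2‖) μ ∧
  ∀ (F : (Fin n → ℝ) → ℝ) (DF : Torus n → (Fin n → ℝ) →L[ℝ] ℝ),
    ContDiff ℝ 1 F → ZPeriodic F →
    (∀ x : Fin n → ℝ, DF (Torus.proj x) = fderiv ℝ F x) →
    ∫ p : Torus n × (Fin n → ℝ), DF p.1 p.2 ∂μ = 0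

/-- The rotation vector (Schwartzman asymptotic cycle) `ρ(μ) = ∫ v dμ(x,v) ∈ ℝⁿ`. -/
def rotationVector {n : ℕ} (μ : Measure (Torus n × (Fin n → ℝ))) : Fin n → ℝ :=
  ∫ p : Torus n × (Fin n → ℝ), p.2 ∂μ

/-- A Tonelli Lagrangian on `𝕋ⁿ`: a `C²` function `L : 𝕋ⁿ × ℝⁿ → ℝ` (read through the
projection `ℝⁿ → 𝕋ⁿ`), fiberwise strictly convex in `v` with positive definite second
fiber derivative, and uniformly superlinear in `v`. -/
structure TonelliLagrangian (n : ℕ) where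
  val : Torus n × (Fin n → ℝ) → ℝ
  smooth : ContDiff ℝ 2 (fun p : (Fin n → ℝ) × (Fin n → ℝ) => val (Torus.proj p.1, p.2))
  strictconvex : ∀ (x : Torus n) (v w : Fin n → ℝ), w ≠ 0 →
    0 < iteratedFDeriv ℝ 2 (fun u => val (x, u)) v ![w, w]
  superlinear : ∀ A : ℝ, ∃ C : ℝ, ∀ p : Torus n × (Fin n → ℝ), A * ‖p.2‖ + C ≤ val p
  cont : Continuous val

/-- Mather's β-function of a Lagrangian `L : 𝕋ⁿ × ℝⁿ → ℝ`:
`β_L(h) = inf { ∫ L dμ : μ closed, ρ(μ) = h }` (the infimum being over measures of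
finite action, the others having infinite action). -/
def betaL {n : ℕ} (L : Torus n × (Fin n → ℝ) → ℝ) (h : Fin n → ℝ) : ℝ :=
  sInf {r : ℝ | ∃ μ : Measure (Torus n × (Fin n → ℝ)),
    IsClosedMeasure μ ∧ rotationVector μ = h ∧ Integrable L μ ∧ r = ∫ p, L p ∂μ}

/-- A Mather (minimizing) measure of the Lagrangian `L` with rotation vector `h`. -/
def IsMatherMeasureL {n : ℕ} (L : Torus n × (Fin n → ℝ) → ℝ) (h : Fin n → ℝ)
    (μ : Measure (Torus n × (Fin n → ℝ))) : Prop :=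
  IsClosedMeasure μ ∧ rotationVector μ = h ∧ Integrable L μ ∧ ∫ p, L p ∂μ = betaL L h

/-- The (topological) support of a measure. -/
def measureSupport {α : Type*} [TopologicalSpace α] {_ : MeasurableSpace α}
    (μ : Measure α) : Set α :=
  {p | ∀ U : Set α, IsOpen U → p ∈ U → μ U ≠ 0}

end

/-- The projection `ℝⁿ → 𝕋ⁿ` is an open quotient map. -/
theorem Torus.isOpenQuotientMap_proj {n : ℕ} :
    IsOpenQuotientMap (Torus.proj : (Fin n → ℝ) → Torus n) :=
  IsOpenQuotientMap.piMap fun _ => QuotientAddGroup.isOpenQuotientMap_mk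

theorem Torus.proj_add {n : ℕ} (x y : Fin n → ℝ) :
    Torus.proj (x + y) = Torus.proj x + Torus.proj y := rfl

/-- A `ℤⁿ`-periodic function is constant on the fibers of `ℝⁿ → 𝕋ⁿ`. -/
theorem ZPeriodic.eq_of_proj_eq {n : ℕ} {E : Type*} {F : (Fin n → ℝ) → E} (hF : ZPeriodic F)
    {x y : Fin n → ℝ} (hxy : Torus.proj x = Torus.proj y) : F x = F y := by
  have hk : ∀ i, ∃ k : ℤ, x i = y i + k := by
    intro i
    have hi : ((x i : ℝ) : AddCircle (1 : ℝ)) = (y i : ℝ) := congrFun hxy i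
    rw [← sub_eq_zero, ← AddCircle.coe_sub, AddCircle.coe_eq_zero_iff] at hi
    obtain ⟨k, hk⟩ := hi
    refine ⟨k, ?_⟩
    simp only [zsmul_eq_mul, mul_one] at hk
    linarith
  choose k hk using hk
  have hx : x = y + fun i => (k i : ℝ) := funext hk
  rw [hx, hF]

/-- The normalized Haar measure on `𝕋ⁿ`. -/
noncomputable def Torus.haar (n : ℕ) : Measure (Torus n) :=
  Measure.pi fun _ => (AddCircle.haarAddCircle : Measure (AddCircle (1 : ℝ)))

instance (n : ℕ) : IsProbabilityMeasure (Torus.haar n) := by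
  unfold Torus.haar; infer_instance

instance (n : ℕ) : (Torus.haar n).IsAddLeftInvariant := by
  unfold Torus.haar; infer_instance

instance (n : ℕ) : (Torus.haar n).IsOpenPosMeasure := by
  unfold Torus.haar; infer_instance

theorem Torus.integrable_haar {n : ℕ} {f : Torus n → ℝ} (hf : Continuous f) :
    Integrable f (Torus.haar n) := by
  rw [← integrableOn_univ]
  exact hf.continuousOn.integrableOn_compact isCompact_univ

/-- The directional derivative of a `C¹` function on the torus has zero Haar average. -/
theorem Torus.integral_directional_deriv_eq_zero {n : ℕ} {F : (Fin n → ℝ) → ℝ}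
    {DF : Torus n → (Fin n → ℝ) →L[ℝ] ℝ} (hF : ContDiff ℝ 1 F) (hper : ZPeriodic F)
    (hDF : ∀ x : Fin n → ℝ, DF (Torus.proj x) = fderiv ℝ F x) (h : Fin n → ℝ) :
    ∫ y, DF y h ∂(Torus.haar n) = 0 := by
  have hq := Torus.isOpenQuotientMap_proj (n := n)
  have hcont : Continuous DF := by
    rw [hq.isQuotientMap.continuous_iff]
    have : DF ∘ Torus.proj = fderiv ℝ F := funext hDF
    rw [this]
    exact hF.continuous_fderiv one_ne_zero
  obtain ⟨s, hs⟩ := hq.surjective.hasRightInverse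
  set f : Torus n → ℝ := fun y => F (s y)
  have hfp : ∀ x, f (Torus.proj x) = F x := fun x => hper.eq_of_proj_eq (hs _)
  have hfc : Continuous f := by
    rw [hq.isQuotientMap.continuous_iff]
    have : f ∘ Torus.proj = F := funext hfp
    rw [this]
    exact hF.continuous
  have hgc : Continuous fun y => DF y h := hcont.clm_apply continuous_const
  have hpt : Continuous fun t : ℝ => (Torus.proj (t • h) : Torus n) :=
    hq.continuous.comp (continuous_id.smul continuous_const)
  have hftc : ∀ y, ∫ t in (0 : ℝ)..1, DF (Torus.proj (t • h) + y) h
      = f (Torus.proj h + y) - f y := by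
    intro y
    obtain ⟨x, rfl⟩ := hq.surjective y
    have hd : ∀ t ∈ Set.uIcc (0 : ℝ) 1, HasDerivAt (fun t : ℝ => F (t • h + x))
        (DF (Torus.proj (t • h) + Torus.proj x) h) t := by
      intro t _
      rw [← Torus.proj_add, hDF]
      have h1 : HasDerivAt (fun t : ℝ => t • h + x) h t := by
        simpa using ((hasDerivAt_id t).smul_const h).add_const x
      exact ((hF.differentiable one_ne_zero _).hasFDerivAt).comp_hasDerivAt t h1
    rw [intervalIntegral.integral_eq_sub_of_hasDerivAt hd, ← Torus.proj_add, hfp, hfp]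
    · simp
    · exact (hgc.comp (hpt.add continuous_const)).intervalIntegrable _ _
  have hjoint : Continuous fun p : Torus n × ℝ => DF (Torus.proj (p.2 • h) + p.1) h :=
    hgc.comp ((hpt.comp continuous_snd).add continuous_fst)
  have hswap : ∫ y, (∫ t in (0 : ℝ)..1, DF (Torus.proj (t • h) + y) h) ∂(Torus.haar n)
      = ∫ t in (0 : ℝ)..1, (∫ y, DF (Torus.proj (t • h) + y) h ∂(Torus.haar n)) := by
    simp only [intervalIntegral.integral_of_le zero_le_one]
    refine integral_integral_swap (f := fun y t => DF (Torus.proj (t • h) + y) h) ?_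
    have hK : IntegrableOn (fun p : Torus n × ℝ => DF (Torus.proj (p.2 • h) + p.1) h)
        (Set.univ ×ˢ Set.Icc 0 1) ((Torus.haar n).prod volume) :=
      hjoint.continuousOn.integrableOn_compact (isCompact_univ.prod isCompact_Icc)
    have hK' := hK.mono_set (Set.prod_mono_right (s := Set.univ)
      (Set.Ioc_subset_Icc_self (a := (0 : ℝ)) (b := 1)))
    rw [IntegrableOn, ← Measure.prod_restrict, Measure.restrict_univ] at hK'
    exact hK'
  simp only [hftc] at hswap
  rw [integral_sub (Torus.integrable_haar (by fun_prop)) (Torus.integrable_haar hfc),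
    integral_add_left_eq_self f] at hswap
  simp only [integral_add_left_eq_self fun y => DF y h] at hswap
  simpa using hswap.symm

/-- The measure `Haar ⊗ δ_h` on `𝕋ⁿ × ℝⁿ`, carried by the linear flow of velocity `h`. -/
noncomputable def Torus.linearFlowMeasure {n : ℕ} (h : Fin n → ℝ) :
    Measure (Torus n × (Fin n → ℝ)) :=
  (Torus.haar n).map fun x => (x, h)

theorem Torus.integral_linearFlowMeasure {n : ℕ} {E : Type*} [NormedAddCommGroup E]
    [NormedSpace ℝ E] (h : Fin n → ℝ) (f : Torus n × (Fin n → ℝ) → E) :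
    ∫ p, f p ∂(Torus.linearFlowMeasure h) = ∫ x, f (x, h) ∂(Torus.haar n) :=
  (measurableEmbedding_prod_mk_right h).integral_map f

theorem Torus.integrable_linearFlowMeasure {n : ℕ} {h : Fin n → ℝ}
    {f : Torus n × (Fin n → ℝ) → ℝ} (hf : Continuous fun x => f (x, h)) :
    Integrable f (Torus.linearFlowMeasure h) :=
  (measurableEmbedding_prod_mk_right h).integrable_map_iff.2 (Torus.integrable_haar hf)

theorem Torus.isClosedMeasure_linearFlowMeasure {n : ℕ} (h : Fin n → ℝ) :
    IsClosedMeasure (Torus.linearFlowMeasure h) := by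
  refine ⟨Measure.isProbabilityMeasure_map measurable_prodMk_right.aemeasurable,
    Torus.integrable_linearFlowMeasure (by fun_prop), fun F DF hF hper hDF => ?_⟩
  rw [Torus.integral_linearFlowMeasure]
  exact Torus.integral_directional_deriv_eq_zero hF hper hDF h

theorem Torus.rotationVector_linearFlowMeasure {n : ℕ} (h : Fin n → ℝ) :
    rotationVector (Torus.linearFlowMeasure h) = h := by
  rw [rotationVector, Torus.integral_linearFlowMeasure]
  simp

/-- For a convex integrable Lagrangian, `ℓ(h) ≤ β_ℓ(h)`. -/
theorem le_betaL_of_convexOn {n : ℕ} {ℓ : (Fin n → ℝ) → ℝ} (hc : Continuous ℓ)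
    (hconv : ConvexOn ℝ Set.univ ℓ) (h : Fin n → ℝ) :
    ℓ h ≤ betaL (fun p : Torus n × (Fin n → ℝ) => ℓ p.2) h := by
  refine le_csInf ⟨_, Torus.linearFlowMeasure h, Torus.isClosedMeasure_linearFlowMeasure h,
    Torus.rotationVector_linearFlowMeasure h,
    Torus.integrable_linearFlowMeasure (by fun_prop), rfl⟩ ?_
  rintro r ⟨μ, ⟨hμ, hint, -⟩, hrot, hL, rfl⟩
  have hsnd : Integrable (fun p : Torus n × (Fin n → ℝ) => p.2) μ :=
    (integrable_norm_iff measurable_snd.aestronglyMeasurable).1 hint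
  have := hconv.map_integral_le hc.continuousOn isClosed_univ
    (Filter.Eventually.of_forall fun _ => Set.mem_univ _) hsnd hL
  rwa [← hrot]

/-- Let `ℓ : ℝⁿ → ℝ` be `C²`, strictly convex and superlinear, regarded
as the completely integrable Tonelli Lagrangian `L(x,v) = ℓ(v)` on `𝕋ⁿ`, and let `V` be a
`C²` potential with `max V = 0`. For `h ≠ 0`, `β_{ℓ+V}(h) = β_ℓ(h)` iff `V ≡ 0`. -/
theorem mane_rigidity_integrable {n : ℕ} (ℓ : (Fin n → ℝ) → ℝ)
    (hℓsmooth : ContDiff ℝ 2 ℓ)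
    (hℓconv : StrictConvexOn ℝ Set.univ ℓ)
    (hℓsuper : ∀ A : ℝ, ∃ C : ℝ, ∀ v : Fin n → ℝ, A * ‖v‖ + C ≤ ℓ v)
    (V : Torus n → ℝ)
    (hVsmooth : ContDiff ℝ 2 (fun x : Fin n → ℝ => V (Torus.proj x)))
    (hVle : ∀ x, V x ≤ 0) (hV0 : ∃ x, V x = 0)
    (h : Fin n → ℝ) (hh : h ≠ 0) :
    betaL (fun p : Torus n × (Fin n → ℝ) => ℓ p.2 + V p.1) h =
        betaL (fun p : Torus n × (Fin n → ℝ) => ℓ p.2) h ↔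
      ∀ x, V x = 0 := by
  refine ⟨fun heq => ?_, fun hV => by simp [hV]⟩
  have hVc : Continuous V :=
    (Torus.isOpenQuotientMap_proj.isQuotientMap.continuous_iff).2 hVsmooth.continuous
  obtain ⟨C, hC⟩ := hℓsuper 0
  obtain ⟨x₀, hx₀⟩ := hVc.exists_forall_le_of_hasCompactSupport
    (HasCompactSupport.of_compactSpace V)
  have hle : betaL (fun p : Torus n × (Fin n → ℝ) => ℓ p.2 + V p.1) h
      ≤ ℓ h + ∫ x, V x ∂(Torus.haar n) := by
    refine csInf_le ⟨C + V x₀, ?_⟩ ⟨Torus.linearFlowMeasure h,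
      Torus.isClosedMeasure_linearFlowMeasure h, Torus.rotationVector_linearFlowMeasure h,
      Torus.integrable_linearFlowMeasure (by fun_prop), ?_⟩
    · rintro r ⟨μ, ⟨hμ, -, -⟩, -, hL, rfl⟩
      have hmono := integral_mono (integrable_const (C + V x₀)) hL fun p => by
        have := hC p.2
        have := hx₀ p.1
        show C + V x₀ ≤ ℓ p.2 + V p.1
        linarith
      simpa using hmono
    · rw [Torus.integral_linearFlowMeasure]
      dsimp only
      rw [integral_add (integrable_const _) (Torus.integrable_haar hVc)]
      simp
  have hge := le_betaL_of_convexOn hℓsmooth.continuous hℓconv.convexOn h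
  have hnonneg : 0 ≤ ∫ x, V x ∂(Torus.haar n) := by linarith
  have hneg : ∫ x, -V x ∂(Torus.haar n) = 0 := by
    rw [integral_neg]
    linarith [integral_nonpos (μ := Torus.haar n) hVle]
  rw [integral_eq_zero_iff_of_nonneg (fun x => neg_nonneg.2 (hVle x))
    (Torus.integrable_haar hVc).neg] at hneg
  have hzero := Measure.eq_of_ae_eq hneg hVc.neg continuous_zero
  exact fun x => neg_eq_zero.1 (congrFun hzero x)
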